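/- arXiv:1511.06119 — 2 statements merged into one kernel-verified Lean document; each statement's English description precedes it below -/
import Mathlib

section
/- Fix k ≥ 1. Let G = (V,E), P ⊆ V × V and G' = (V',E') be as in the reduction construction (for every v ∈ V a set V_v of (k+1)^2 new vertices joined to v; for every pair {u,v} ∉ P of distinct vertices a set V_{(u,v)} of (k+1)^2 new vertices joined to both u and v; all new vertices pairwise adjacent). If G' admits a total coloring with 3 colors making every two distinct vertices of G' total rainbow k-connected, then the restriction of this coloring to G is a 3-total-coloring of G under which every pair {u,v} ∈ P is total rainbow k-connected. (This uses that no pair of vertices of G appearing in P has a path of length two in G' that is not fully contained in G.) -/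
open SimpleGraph

namespace Paper

variable {V : Type*}

/-- The internal vertices of a walk (all vertices except the two endpoints). -/
def internalSupport {G : SimpleGraph V} {u v : V} (p : G.Walk u v) : List V :=
  p.support.tail.dropLast

/-- A family of walks between two fixed vertices is internally disjoint if the walks
are pairwise distinct and no two of them share an internal vertex. -/
def InternallyDisjoint {G : SimpleGraph V} {u v : V} {k : ℕ}
    (P : Fin k → G.Walk u v) : Prop :=
  Function.Injective P ∧
    ∀ i j, i ≠ j → ∀ w, w ∈ internalSupport (P i) → w ∉ internalSupport (P j)

/-- A rainbow path for an edge coloring: a path whose edges have pairwise distinct colors. -/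
def IsRainbowPath {α : Type*} {G : SimpleGraph V} (c : Sym2 V → α)
    {u v : V} (p : G.Walk u v) : Prop :=
  p.IsPath ∧ (p.edges.map c).Nodup

/-- A vertex-rainbow path: a path whose internal vertices have pairwise distinct colors. -/
def IsVertexRainbowPath {α : Type*} {G : SimpleGraph V} (c : V → α)
    {u v : V} (p : G.Walk u v) : Prop :=
  p.IsPath ∧ ((internalSupport p).map c).Nodup

/-- A total rainbow path: a path whose edges and internal vertices all have
pairwise distinct colors. -/
def IsTotalRainbowPath {α : Type*} {G : SimpleGraph V} (cv : V → α) (ce : Sym2 V → α)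
    {u v : V} (p : G.Walk u v) : Prop :=
  p.IsPath ∧ (p.edges.map ce ++ (internalSupport p).map cv).Nodup

/-- `G` is rainbow `k`-connected under the edge coloring `c`: any two distinct vertices are
joined by `k` pairwise internally vertex-disjoint rainbow paths. -/
def RainbowKConnected {α : Type*} (G : SimpleGraph V) (c : Sym2 V → α) (k : ℕ) : Prop :=
  ∀ u v : V, u ≠ v → ∃ P : Fin k → G.Walk u v,
    (∀ i, IsRainbowPath c (P i)) ∧ InternallyDisjoint P

/-- `G` is rainbow vertex `k`-connected under the vertex coloring `c`. -/
def VertexRainbowKConnected {α : Type*} (G : SimpleGraph V) (c : V → α) (k : ℕ) : Prop :=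
  ∀ u v : V, u ≠ v → ∃ P : Fin k → G.Walk u v,
    (∀ i, IsVertexRainbowPath c (P i)) ∧ InternallyDisjoint P

/-- The pair `u, v` is total rainbow `k`-connected under the total coloring `(cv, ce)`:
`u` and `v` are joined by `k` pairwise internally vertex-disjoint total rainbow paths. -/
def TotalRainbowKConnectedPair {α : Type*} (G : SimpleGraph V)
    (cv : V → α) (ce : Sym2 V → α) (k : ℕ) (u v : V) : Prop :=
  ∃ P : Fin k → G.Walk u v,
    (∀ i, IsTotalRainbowPath cv ce (P i)) ∧ InternallyDisjoint P

/-- `G` is total rainbow `k`-connected under the total coloring `(cv, ce)`. -/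
def TotalRainbowKConnected {α : Type*} (G : SimpleGraph V)
    (cv : V → α) (ce : Sym2 V → α) (k : ℕ) : Prop :=
  ∀ u v : V, u ≠ v → TotalRainbowKConnectedPair G cv ce k u v

/-- The rainbow `k`-connection number: the least number of colors of an edge coloring
making `G` rainbow `k`-connected. -/
noncomputable def rcK (G : SimpleGraph V) (k : ℕ) : ℕ :=
  sInf {t | ∃ c : Sym2 V → Fin t, RainbowKConnected G c k}

/-- The rainbow vertex `k`-connection number. -/
noncomputable def rvcK (G : SimpleGraph V) (k : ℕ) : ℕ :=
  sInf {t | ∃ c : V → Fin t, VertexRainbowKConnected G c k}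

/-- The total rainbow `k`-connection number. -/
noncomputable def trcK (G : SimpleGraph V) (k : ℕ) : ℕ :=
  sInf {t | ∃ (cv : V → Fin t) (ce : Sym2 V → Fin t), TotalRainbowKConnected G cv ce k}

/-- `G` is `l`-connected: it has more than `l` vertices and deleting any set of fewer than
`l` vertices leaves a connected graph. -/
def IsLConnected (G : SimpleGraph V) [Fintype V] (l : ℕ) : Prop :=
  l < Fintype.card V ∧
    ∀ S : Set V, S.ncard < l → (G.induce Sᶜ).Connected

/-- Index set for the `(k+1)²` new vertices of each added clique, viewed as
`{(i,l) : 1 ≤ i,l ≤ k+1}`. -/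
abbrev Idx (k : ℕ) := Fin (k + 1) × Fin (k + 1)

/-- Unordered pairs `{u,v}` of distinct vertices with `{u,v} ∉ P`, represented by their
increasingly ordered representative. -/
abbrev PairNotP (V : Type*) [LinearOrder V] (P : Set (Sym2 V)) : Type _ :=
  {q : V × V // q.1 < q.2 ∧ s(q.1, q.2) ∉ P}

/-- The new vertices of the reduction graph `G'`: for each `v ∈ V` a set `V_v` of `(k+1)²`
vertices, and for each pair `{u,v} ∉ P` of distinct vertices a set `V_{(u,v)}` of `(k+1)²`
vertices. -/
abbrev NewVert (V : Type*) [LinearOrder V] (P : Set (Sym2 V)) (k : ℕ) : Type _ :=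
  (V × Idx k) ⊕ (PairNotP V P × Idx k)

/-- The adjacency generating relation of the reduction graph `G'`: edges of `G`; edges
`v x` for `x ∈ V_v`; edges `u x` and `v x` for `x ∈ V_{(u,v)}`, `{u,v} ∉ P`; and all
edges between new vertices. -/
def bigRel {V : Type*} [LinearOrder V] (G : SimpleGraph V) (P : Set (Sym2 V)) (k : ℕ) :
    (V ⊕ NewVert V P k) → (V ⊕ NewVert V P k) → Prop
  | Sum.inl a, Sum.inl b => G.Adj a b
  | Sum.inl a, Sum.inr (Sum.inl (v, _)) => a = v
  | Sum.inl a, Sum.inr (Sum.inr (q, _)) => a = q.1.1 ∨ a = q.1.2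
  | Sum.inr _, Sum.inr _ => True
  | _, _ => False

/-- The reduction graph `G'` of the proof of Lemma 2.2. -/
def bigGraph {V : Type*} [LinearOrder V] (G : SimpleGraph V) (P : Set (Sym2 V)) (k : ℕ) :
    SimpleGraph (V ⊕ NewVert V P k) :=
  SimpleGraph.fromRel (bigRel G P k)

theorem internalSupport_map {W : Type*} {G : SimpleGraph V} {H : SimpleGraph W} (f : G →g H)
    {u v : V} (p : G.Walk u v) :
    internalSupport (p.map f) = (internalSupport p).map f := by
  simp [internalSupport, Walk.support_map, List.map_tail, List.map_dropLast]

/-- A total rainbow path of length `n` uses `2 n - 1` colors. -/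
theorem IsTotalRainbowPath.two_mul_length_le {α : Type*} [Fintype α] {G : SimpleGraph V}
    {cv : V → α} {ce : Sym2 V → α} {u v : V} {p : G.Walk u v}
    (hp : IsTotalRainbowPath cv ce p) : 2 * p.length ≤ Fintype.card α + 1 := by
  have hcard := hp.2.length_le_card
  simp only [internalSupport, List.length_append, List.length_map, Walk.length_edges,
    List.length_dropLast, List.length_tail, Walk.length_support] at hcard
  omega

/-- A walk whose image under a graph homomorphism is a total rainbow path is itself total
rainbow for the pulled back coloring. -/
theorem IsTotalRainbowPath.of_map {W α : Type*} {G : SimpleGraph V} {H : SimpleGraph W}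
    {f : G →g H} {cv : W → α} {ce : Sym2 W → α} {u v : V} {p : G.Walk u v}
    (hp : IsTotalRainbowPath cv ce (p.map f)) :
    IsTotalRainbowPath (fun x => cv (f x)) (fun e => ce (e.map f)) p := by
  refine ⟨hp.1.of_map, ?_⟩
  have hnodup := hp.2
  rw [Walk.edges_map, internalSupport_map, List.map_map, List.map_map] at hnodup
  exact hnodup

theorem InternallyDisjoint.of_map {W : Type*} {G : SimpleGraph V} {H : SimpleGraph W}
    {f : G →g H} {u v : V} {k : ℕ} {Q : Fin k → G.Walk u v}
    (hQ : InternallyDisjoint fun i => (Q i).map f) : InternallyDisjoint Q := by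
  refine ⟨fun i j hij => hQ.1 (congrArg (Walk.map f) hij), fun i j hij w hi hj => ?_⟩
  refine hQ.2 i j hij (f w) ?_ ?_ <;> rw [internalSupport_map]
  exacts [List.mem_map_of_mem hi, List.mem_map_of_mem hj]

section BigGraph

variable {V : Type*} [LinearOrder V] {G : SimpleGraph V} {P : Set (Sym2 V)} {k : ℕ} {u v : V}

theorem bigGraph_adj_inl_inl :
    (bigGraph G P k).Adj (Sum.inl u) (Sum.inl v) ↔ G.Adj u v := by
  simp only [bigGraph, fromRel_adj, bigRel, ne_eq, Sum.inl.injEq, G.adj_comm v u, or_self]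
  exact ⟨And.right, fun h => ⟨h.ne, h⟩⟩

/-- The inclusion of `G` into the reduction graph. -/
def bigGraphInl (G : SimpleGraph V) (P : Set (Sym2 V)) (k : ℕ) : G →g bigGraph G P k where
  toFun := Sum.inl
  map_rel' := bigGraph_adj_inl_inl.2

/-- Two vertices of a pair in `P` have no common neighbor among the new vertices. -/
theorem not_bigGraph_adj_inr_of_mem (huv : u ≠ v) (hmem : s(u, v) ∈ P) {x : NewVert V P k}
    (hu : (bigGraph G P k).Adj (Sum.inl u) (Sum.inr x)) :
    ¬(bigGraph G P k).Adj (Sum.inr x) (Sum.inl v) := by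
  intro hv
  rcases x with ⟨w, _⟩ | ⟨⟨⟨a, b⟩, _, hab⟩, _⟩
  · simp only [bigGraph, fromRel_adj, bigRel, or_false, false_or] at hu hv
    exact huv (hu.2.trans hv.2.symm)
  · simp only [bigGraph, fromRel_adj, bigRel, or_false, false_or] at hu hv
    rcases hu.2 with rfl | rfl <;> rcases hv.2 with rfl | rfl
    · exact huv rfl
    · exact hab hmem
    · exact hab (Sym2.eq_swap ▸ hmem)
    · exact huv rfl

/-- Walks of length at most two in the reduction graph between the vertices of a pair in `P`
lie inside `G`. -/
theorem exists_map_bigGraphInl_eq (huv : u ≠ v) (hmem : s(u, v) ∈ P)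
    (p : (bigGraph G P k).Walk (Sum.inl u) (Sum.inl v)) (hp : p.length ≤ 2) :
    ∃ q : G.Walk u v, q.map (bigGraphInl G P k) = p := by
  match p, hp with
  | .nil, _ => exact absurd rfl huv
  | .cons hadj .nil, _ => exact ⟨.cons (bigGraph_adj_inl_inl.1 hadj) .nil, rfl⟩
  | .cons (v := .inl _) hadj (.cons hadj' .nil), _ =>
    exact ⟨.cons (bigGraph_adj_inl_inl.1 hadj) (.cons (bigGraph_adj_inl_inl.1 hadj') .nil), rfl⟩
  | .cons (v := .inr _) hadj (.cons hadj' .nil), _ =>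
    exact absurd hadj' (not_bigGraph_adj_inr_of_mem huv hmem hadj)
  | .cons _ (.cons _ (.cons _ _)), hp =>
    simp only [Walk.length_cons] at hp
    omega

end BigGraph

/-- If `G'` admits a total coloring with `3` colors making every two
distinct vertices of `G'` total rainbow `k`-connected, then the restriction of this
coloring to `G` makes every pair in `P` total rainbow `k`-connected in `G`. -/
theorem bigGraph_trc3_restrict {V : Type*} [LinearOrder V] (k : ℕ) (hk : 1 ≤ k)
    (G : SimpleGraph V) (hG : G.Connected) (P : Set (Sym2 V))
    (hP : ∀ u v : V, s(u, v) ∈ P → u ≠ v ∧ ¬G.Adj u v)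
    (cv' : (V ⊕ NewVert V P k) → Fin 3) (ce' : Sym2 (V ⊕ NewVert V P k) → Fin 3)
    (h : TotalRainbowKConnected (bigGraph G P k) cv' ce' k) :
    ∀ u v : V, s(u, v) ∈ P →
      TotalRainbowKConnectedPair G (fun x => cv' (Sum.inl x))
        (fun e => ce' (e.map Sum.inl)) k u v := by
  intro u v hmem
  have huv := (hP u v hmem).1
  obtain ⟨p, hp, hdisj⟩ := h (Sum.inl u) (Sum.inl v) (Sum.inl_injective.ne huv)
  have hlen : ∀ i, (p i).length ≤ 2 := fun i => by
    have hi := (hp i).two_mul_length_le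
    rw [Fintype.card_fin] at hi
    omega
  choose q hq using fun i => exists_map_bigGraphInl_eq huv hmem (p i) (hlen i)
  obtain rfl : (fun i => (q i).map (bigGraphInl G P k)) = p := funext hq
  exact ⟨q, fun i => (hp i).of_map, hdisj.of_map⟩

end Paper
end

section
/- Let G be an ℓ-connected graph with ℓ ≥ 1 and let k be an integer with 1 ≤ k ≤ ℓ. If rc_k(G) = 2, then trc_k(G) = 3. -/
open SimpleGraph

namespace Paper

variable {V : Type*}

theorem length_internalSupport {G : SimpleGraph V} {u v : V} (p : G.Walk u v) :
    (internalSupport p).length = p.length - 1 := by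
  simp [internalSupport]

theorem nodup_map_of_length_le_one {α β : Type*} (f : α → β) {l : List α} (h : l.length ≤ 1) :
    (l.map f).Nodup := by
  match l, h with
  | [], _ => simp
  | [a], _ => simp

theorem IsRainbowPath.length_le {G : SimpleGraph V} {t : ℕ} {c : Sym2 V → Fin t} {u v : V}
    {p : G.Walk u v} (h : IsRainbowPath c p) : p.length ≤ t := by
  simpa using h.2.length_le_card

theorem IsTotalRainbowPath.length_add_le {G : SimpleGraph V} {t : ℕ} {cv : V → Fin t}
    {ce : Sym2 V → Fin t} {u v : V} {p : G.Walk u v} (h : IsTotalRainbowPath cv ce p) :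
    p.length + (p.length - 1) ≤ t := by
  simpa [length_internalSupport] using h.2.length_le_card

/-- A rainbow path in two colors stays total rainbow when all vertices get one new color. -/
theorem IsRainbowPath.isTotalRainbowPath {G : SimpleGraph V} {c : Sym2 V → Fin 2} {u v : V}
    {p : G.Walk u v} (h : IsRainbowPath c p) :
    IsTotalRainbowPath (fun _ => Fin.last 2) (fun e => (c e).castSucc) p := by
  refine ⟨h.1, List.Nodup.append ?_ (nodup_map_of_length_le_one _ ?_) ?_⟩
  · simpa [List.map_map, Function.comp_def] using h.2.map (Fin.castSucc_injective 2)
  · have := h.length_le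
    rw [length_internalSupport]
    omega
  · intro a ha hb
    obtain ⟨e, -, rfl⟩ := List.mem_map.1 ha
    obtain ⟨w, -, hw⟩ := List.mem_map.1 hb
    exact Fin.castSucc_ne_last _ hw.symm

theorem RainbowKConnected.totalRainbowKConnected {G : SimpleGraph V} {c : Sym2 V → Fin 2} {k : ℕ}
    (h : RainbowKConnected G c k) :
    TotalRainbowKConnected G (fun _ => Fin.last 2) (fun e => (c e).castSucc) k := by
  intro u v huv
  obtain ⟨P, hP, hd⟩ := h u v huv
  exact ⟨P, fun i => (hP i).isTotalRainbowPath, hd⟩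

/-- With at most two colors, total rainbow paths are single edges, so one color suffices for
rainbow `k`-connection. -/
theorem TotalRainbowKConnected.rainbowKConnected {G : SimpleGraph V} {t k : ℕ} {cv : V → Fin t}
    {ce : Sym2 V → Fin t} (h : TotalRainbowKConnected G cv ce k) (ht : t ≤ 2) :
    RainbowKConnected G (fun _ => (0 : Fin 1)) k := by
  intro u v huv
  obtain ⟨P, hP, hd⟩ := h u v huv
  refine ⟨P, fun i => ⟨(hP i).1, nodup_map_of_length_le_one _ ?_⟩, hd⟩
  have := (hP i).length_add_le
  rw [Walk.length_edges]
  omega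

/-- Let `G` be an `ℓ`-connected graph with `ℓ ≥ 1` and let `k` be an
integer with `1 ≤ k ≤ ℓ`. If `rc_k(G) = 2`, then `trc_k(G) = 3`. -/
theorem trcK_eq_three_of_rcK_eq_two {V : Type*} [Fintype V] (G : SimpleGraph V) (l k : ℕ)
    (hl : 1 ≤ l) (hconn : IsLConnected G l) (hk : 1 ≤ k) (hkl : k ≤ l)
    (hrc : rcK G k = 2) :
    trcK G k = 3 := by
  obtain ⟨c, hc⟩ : ∃ c : Sym2 V → Fin 2, RainbowKConnected G c k := by
    have hne := Nat.nonempty_of_pos_sInf (hrc.trans_gt two_pos : 0 < rcK G k)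
    have hmem := Nat.sInf_mem hne
    rwa [show sInf _ = 2 from hrc] at hmem
  have h3 : 3 ∈ {t | ∃ (cv : V → Fin t) (ce : Sym2 V → Fin t),
      TotalRainbowKConnected G cv ce k} := ⟨_, _, hc.totalRainbowKConnected⟩
  refine le_antisymm (Nat.sInf_le h3) (le_csInf ⟨3, h3⟩ ?_)
  rintro t ⟨cv, ce, h⟩
  by_contra! ht
  have : rcK G k ≤ 1 := Nat.sInf_le ⟨_, h.rainbowKConnected (by omega)⟩
  omega

end Paper
end
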